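/- arXiv:2503.03577 — 2 statements merged into one kernel-verified Lean document; each statement's English description precedes it below -/
import Mathlib

section
/- For every n ≥ 5 and every k ≥ 1 with k ≤ n/2, there exists a saturated precolored convex Θ^k-drawing of a graph G on n vertices with at most (k+4)(n−2)/2 edges, i.e., 2·|E(G)| ≤ (k+4)(n−2). -/
/-- Points of the plane. -/
abbrev Pt : Type := ℝ × ℝ

/-- Two straight-line segments cross if some point lies in the interior
(open segment) of both. -/
def SegCross (a b c d : Pt) : Prop :=
  ∃ x : Pt, x ∈ openSegment ℝ a b ∧ x ∈ openSegment ℝ c d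

/-- Two edges (unordered pairs of vertices) cross in the drawing `p`. -/
def EdgeCross {V : Type} (p : V → Pt) (e f : Sym2 V) : Prop :=
  ∃ u v x y : V, e = s(u, v) ∧ f = s(x, y) ∧ SegCross (p u) (p v) (p x) (p y)

/-- The drawing `p` is injective and no three vertex points are collinear. -/
def GenPos {V : Type} (p : V → Pt) : Prop :=
  Function.Injective p ∧
    ∀ u v w : V, u ≠ v → u ≠ w → v ≠ w → ¬ Collinear ℝ ({p u, p v, p w} : Set Pt)

/-- The vertex points are in convex position: every vertex point is an extreme
point of the convex hull of all vertex points. -/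
def ConvexPos {V : Type} (p : V → Pt) : Prop :=
  ∀ v : V, p v ∈ Set.extremePoints ℝ (convexHull ℝ (Set.range p))

/-- A `k`-coloring of the edges of `G` is crossing-free if no two distinct
edges of the same color cross. -/
def CrossingFree {V : Type} {k : ℕ} (G : SimpleGraph V) (p : V → Pt)
    (φ : Sym2 V → Fin k) : Prop :=
  ∀ e ∈ G.edgeSet, ∀ f ∈ G.edgeSet, e ≠ f → φ e = φ f → ¬ EdgeCross p e f

open scoped Classical

/-- A precolored drawing `(G, p, φ)` is saturated: for every pair of distinct
non-adjacent vertices and every color `c`, assigning color `c` to the new edge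
`uv` yields a coloring that is not crossing-free. -/
def PrecoloredSaturated {V : Type} {k : ℕ} (G : SimpleGraph V) (p : V → Pt)
    (φ : Sym2 V → Fin k) : Prop :=
  ∀ u v : V, u ≠ v → ¬ G.Adj u v → ∀ c : Fin k,
    ¬ CrossingFree (G ⊔ SimpleGraph.fromEdgeSet {s(u, v)}) p
      (fun e => if e = s(u, v) then c else φ e)

/-- A (non-precolored) drawing of `G` is saturated for thickness `k`: for every
pair of distinct non-adjacent vertices `u, v`, the drawing of `G + uv` admits
no crossing-free `k`-coloring. -/
def Saturated {V : Type} (k : ℕ) (G : SimpleGraph V) (p : V → Pt) : Prop :=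
  ∀ u v : V, u ≠ v → ¬ G.Adj u v →
    ∀ φ : Sym2 V → Fin k,
      ¬ CrossingFree (G ⊔ SimpleGraph.fromEdgeSet {s(u, v)}) p φ

/-- Twice the signed area of the triangle `a b c`. -/
def det2 (a b c : Pt) : ℝ :=
  (b.1 - a.1) * (c.2 - a.2) - (b.2 - a.2) * (c.1 - a.1)

/-- An edge is an outer edge if its endpoints are consecutive on the boundary
of the convex hull of the vertex points, i.e. all other vertex points lie
strictly on one side of the line through its endpoints. -/
def IsOuterEdge {V : Type} (p : V → Pt) (e : Sym2 V) : Prop :=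
  ∃ u v : V, e = s(u, v) ∧
    ((∀ w : V, w ≠ u → w ≠ v → 0 < det2 (p u) (p v) (p w)) ∨
     (∀ w : V, w ≠ u → w ≠ v → det2 (p u) (p v) (p w) < 0))

/-- Points on the parabola. -/
noncomputable def par {n : ℕ} (i : Fin n) : Pt := (((i : ℕ) : ℝ), ((i : ℕ) : ℝ) ^ 2)

lemma seg_cross_of {i j k l : ℝ} (h1 : i < k) (h2 : k < j) (h3 : j < l) :
    SegCross (i, i ^ 2) (j, j ^ 2) (k, k ^ 2) (l, l ^ 2) := by
  have hD : 0 < k + l - i - j := by linarith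
  have hji : 0 < j - i := by linarith
  have hlk : 0 < l - k := by linarith
  have e1 : (k * l - i * j) / (k + l - i - j) - k = (k - i) * (j - k) / (k + l - i - j) := by
    field_simp; ring
  have e2 : j - (k * l - i * j) / (k + l - i - j) = (j - k) * (l - j) / (k + l - i - j) := by
    field_simp; ring
  have p1 : 0 < (k - i) * (j - k) / (k + l - i - j) :=
    div_pos (mul_pos (by linarith) (by linarith)) hD
  have p2 : 0 < (j - k) * (l - j) / (k + l - i - j) :=
    div_pos (mul_pos (by linarith) (by linarith)) hD
  have e3 : (i + j) * ((k * l - i * j) / (k + l - i - j)) - i * j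
      = (k + l) * ((k * l - i * j) / (k + l - i - j)) - k * l := by
    field_simp; ring
  rw [← e1] at p1
  rw [← e2] at p2
  generalize (k * l - i * j) / (k + l - i - j) = x at *
  refine ⟨(x, (i + j) * x - i * j), ?_, ?_⟩
  · refine ⟨(j - x) / (j - i), (x - i) / (j - i), div_pos (by linarith) hji,
      div_pos (by linarith) hji, ?_, ?_⟩
    · field_simp; ring
    · ext
      · simp; field_simp; ring
      · simp; field_simp; ring
  · rw [e3]
    refine ⟨(l - x) / (l - k), (x - k) / (l - k), div_pos (by linarith) hlk,
      div_pos (by linarith) hlk, ?_, ?_⟩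
    · field_simp; ring
    · ext
      · simp; field_simp; ring
      · simp; field_simp; ring

lemma seg_cross_symm {a b c d : Pt} (h : SegCross a b c d) : SegCross c d a b := by
  obtain ⟨x, h1, h2⟩ := h
  exact ⟨x, h2, h1⟩

lemma no_cross_sep {i j k l : ℝ} (h1 : i < j) (h2 : j ≤ k) (h3 : k < l) :
    ¬ SegCross (i, i ^ 2) (j, j ^ 2) (k, k ^ 2) (l, l ^ 2) := by
  rintro ⟨x, ⟨a, b, ha, hb, hab, e⟩, ⟨c, d, hc, hd, hcd, e'⟩⟩
  have f1 := congrArg Prod.fst e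
  have f2 := congrArg Prod.fst e'
  simp at f1 f2
  have : a * i + b * j < j := by
    have : a = 1 - b := by linarith
    subst this
    nlinarith
  have : k < c * k + d * l := by
    have : c = 1 - d := by linarith
    subst this
    nlinarith
  linarith

lemma no_cross_nest {i j k l : ℝ} (h1 : i ≤ k) (h2 : k < l) (h3 : l ≤ j) (hne : i < k ∨ l < j) :
    ¬ SegCross (i, i ^ 2) (j, j ^ 2) (k, k ^ 2) (l, l ^ 2) := by
  rintro ⟨x, ⟨a, b, ha, hb, hab, e⟩, ⟨c, d, hc, hd, hcd, e'⟩⟩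
  have f1 := congrArg Prod.fst e
  have f2 := congrArg Prod.fst e'
  have g1 := congrArg Prod.snd e
  have g2 := congrArg Prod.snd e'
  simp at f1 f2 g1 g2
  have z1 : x.2 - (i + j) * x.1 + i * j = 0 := by
    rw [← f1, ← g1]
    have : a = 1 - b := by linarith
    subst this
    ring
  have z2 : x.2 - (i + j) * x.1 + i * j = - (c * ((k - i) * (j - k)) + d * ((l - i) * (j - l))) := by
    rw [← f2, ← g2]
    have : c = 1 - d := by linarith
    subst this
    ring
  have n1 : 0 ≤ (k - i) * (j - k) := mul_nonneg (by linarith) (by linarith)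
  have n2 : 0 ≤ (l - i) * (j - l) := mul_nonneg (by linarith) (by linarith)
  rcases hne with h | h
  · have : 0 < (k - i) * (j - k) := mul_pos (by linarith) (by linarith)
    have := mul_pos hc this
    have := mul_nonneg hd.le n2
    linarith
  · have : 0 < (l - i) * (j - l) := mul_pos (by linarith) (by linarith)
    have := mul_pos hd this
    have := mul_nonneg hc.le n1
    linarith

lemma cross_imp {n : ℕ} {i j k l : Fin n} (hij : i < j) (hkl : k < l)
    (hne : ¬ (i = k ∧ j = l)) (h : SegCross (par i) (par j) (par k) (par l)) :
    (i < k ∧ k < j ∧ j < l) ∨ (k < i ∧ i < l ∧ l < j) := by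
  by_contra hcon
  unfold par at h
  have c1 : ((i : ℕ) : ℝ) < ((j : ℕ) : ℝ) := by exact_mod_cast hij
  have c2 : ((k : ℕ) : ℝ) < ((l : ℕ) : ℝ) := by exact_mod_cast hkl
  have cast_le : ∀ a b : Fin n, a ≤ b → ((a : ℕ) : ℝ) ≤ ((b : ℕ) : ℝ) := by
    intro a b hab; exact_mod_cast hab
  have cast_lt : ∀ a b : Fin n, a < b → ((a : ℕ) : ℝ) < ((b : ℕ) : ℝ) := by
    intro a b hab; exact_mod_cast hab
  have key : j ≤ k ∨ l ≤ i ∨ (i ≤ k ∧ l ≤ j ∧ (i < k ∨ l < j)) ∨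
      (k ≤ i ∧ j ≤ l ∧ (k < i ∨ j < l)) := by
    omega
  rcases key with h1 | h1 | ⟨h1, h2, h3⟩ | ⟨h1, h2, h3⟩
  · exact no_cross_sep c1 (cast_le _ _ h1) c2 h
  · exact no_cross_sep c2 (cast_le _ _ h1) c1 (seg_cross_symm h)
  · exact no_cross_nest (cast_le _ _ h1) c2 (cast_le _ _ h2)
      (h3.imp (cast_lt _ _) (cast_lt _ _)) h
  · exact no_cross_nest (cast_le _ _ h1) c1 (cast_le _ _ h2)
      (h3.imp (cast_lt _ _) (cast_lt _ _)) (seg_cross_symm h)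

lemma seg_comm_left {a b c d : Pt} (h : SegCross a b c d) : SegCross b a c d := by
  unfold SegCross at *
  rwa [openSegment_symm ℝ b a]

lemma seg_comm_right {a b c d : Pt} (h : SegCross a b c d) : SegCross a b d c := by
  unfold SegCross at *
  rwa [openSegment_symm ℝ d c]

lemma par_inj {n : ℕ} : Function.Injective (par (n := n)) := by
  intro i j h
  have := congrArg Prod.fst h
  simp [par] at this
  exact Fin.ext this

lemma par_genPos {n : ℕ} : GenPos (par (n := n)) := by
  refine ⟨par_inj, ?_⟩
  intro u v w huv huw hvw hc
  rw [collinear_iff_of_mem (p₀ := par u) (by simp)] at hc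
  obtain ⟨d, hd⟩ := hc
  obtain ⟨r, hr⟩ := hd (par v) (by simp)
  obtain ⟨s, hs⟩ := hd (par w) (by simp)
  have r1 := congrArg Prod.fst hr
  have r2 := congrArg Prod.snd hr
  have s1 := congrArg Prod.fst hs
  have s2 := congrArg Prod.snd hs
  simp [par] at r1 r2 s1 s2
  have n1 : ((u : ℕ) : ℝ) ≠ ((v : ℕ) : ℝ) := by
    intro h; exact huv (Fin.ext (by exact_mod_cast h))
  have n2 : ((u : ℕ) : ℝ) ≠ ((w : ℕ) : ℝ) := by
    intro h; exact huw (Fin.ext (by exact_mod_cast h))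
  have n3 : ((v : ℕ) : ℝ) ≠ ((w : ℕ) : ℝ) := by
    intro h; exact hvw (Fin.ext (by exact_mod_cast h))
  generalize ((u : ℕ) : ℝ) = x at *
  generalize ((v : ℕ) : ℝ) = y at *
  generalize ((w : ℕ) : ℝ) = z at *
  have a1 : y - x = r * d.1 := by linarith
  have a2 : y ^ 2 - x ^ 2 = r * d.2 := by linarith
  have b1 : z - x = s * d.1 := by linarith
  have b2 : z ^ 2 - x ^ 2 = s * d.2 := by linarith
  have : (y - x) * (z ^ 2 - x ^ 2) = (z - x) * (y ^ 2 - x ^ 2) := by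
    rw [a1, a2, b1, b2]; ring
  have : (y - x) * ((z - x) * (z - y)) = 0 := by linear_combination this
  rcases mul_eq_zero.1 this with h | h
  · exact n1 (by linarith)
  · rcases mul_eq_zero.1 h with h | h
    · exact n2 (by linarith)
    · exact n3 (by linarith)

lemma par_convexPos {n : ℕ} : ConvexPos (par (n := n)) := by
  intro v
  have hsub : convexHull ℝ (Set.range (par (n := n))) ⊆ {q : Pt | q.1 ^ 2 ≤ q.2} := by
    apply convexHull_min
    · rintro _ ⟨i, rfl⟩
      simp [par]
    · intro x hx y hy a b ha hb hab
      simp at hx hy ⊢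
      have : b = 1 - a := by linarith
      subst this
      nlinarith [mul_nonneg (mul_nonneg ha hb) (sq_nonneg (x.1 - y.1)),
        mul_le_mul_of_nonneg_left hx ha, mul_le_mul_of_nonneg_left hy hb]
  have key : ∀ t : ℝ, ∀ x y : Pt, x.1 ^ 2 ≤ x.2 → y.1 ^ 2 ≤ y.2 →
      ((t, t ^ 2) : Pt) ∈ openSegment ℝ x y → x = (t, t ^ 2) := by
    rintro t x y hx hy ⟨a, b, ha, hb, hab, e⟩
    have f1 := congrArg Prod.fst e
    have f2 := congrArg Prod.snd e
    simp at f1 f2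
    have u1 : 0 ≤ x.2 - 2 * t * x.1 + t ^ 2 := by nlinarith [sq_nonneg (x.1 - t)]
    have u2 : 0 ≤ y.2 - 2 * t * y.1 + t ^ 2 := by nlinarith [sq_nonneg (y.1 - t)]
    have e0 : a * (x.2 - 2 * t * x.1 + t ^ 2) + b * (y.2 - 2 * t * y.1 + t ^ 2) = 0 := by
      linear_combination f2 - 2 * t * f1 + t ^ 2 * hab
    have v1 := mul_nonneg ha.le u1
    have v2 := mul_nonneg hb.le u2
    have w : a * (x.2 - 2 * t * x.1 + t ^ 2) = 0 := by linarith
    have w' : x.2 - 2 * t * x.1 + t ^ 2 = 0 := (mul_eq_zero.1 w).resolve_left ha.ne'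
    have : (x.1 - t) ^ 2 = 0 := le_antisymm (by nlinarith) (sq_nonneg _)
    have h1 : x.1 = t := by
      have := pow_eq_zero_iff (two_ne_zero) |>.1 this
      linarith
    ext
    · exact h1
    · simp only
      rw [h1] at w'
      linarith
  rw [mem_extremePoints_iff_left]
  refine ⟨subset_convexHull ℝ _ ⟨v, rfl⟩, ?_⟩
  intro x hx y hy h
  exact key _ x y (hsub hx) (hsub hy) h

/-- Graph given by a relation on increasing pairs. -/
def mkG (n : ℕ) (R : ℕ → ℕ → Prop) : SimpleGraph (Fin n) where
  Adj u v := u ≠ v ∧ R (min (u : ℕ) v) (max (u : ℕ) v)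
  symm := ⟨fun u v h => ⟨h.1.symm, by rw [min_comm, max_comm]; exact h.2⟩⟩
  loopless := ⟨fun u h => h.1 rfl⟩

/-- Coloring given by a function on increasing pairs. -/
def mkC (n k : ℕ) (hk : 0 < k) (col : ℕ → ℕ → ℕ) : Sym2 (Fin n) → Fin k :=
  Sym2.lift ⟨fun u v => ⟨col (min (u : ℕ) v) (max (u : ℕ) v) % k, Nat.mod_lt _ hk⟩, by
    intro u v; simp only [min_comm, max_comm]⟩

lemma mkG_adj {n : ℕ} {R : ℕ → ℕ → Prop} {u v : Fin n} (h : u < v) :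
    (mkG n R).Adj u v ↔ R u v := by
  have h' : (u : ℕ) ≤ v := le_of_lt h
  simp [mkG, min_eq_left h', max_eq_right h', h.ne]

lemma mkC_val {n k : ℕ} {hk : 0 < k} {col : ℕ → ℕ → ℕ} {u v : Fin n} (h : u < v) :
    ((mkC n k hk col s(u, v) : Fin k) : ℕ) = col u v % k := by
  have h' : (u : ℕ) ≤ v := le_of_lt h
  simp [mkC, min_eq_left h', max_eq_right h']

lemma edge_rep {n : ℕ} {R : ℕ → ℕ → Prop} {e : Sym2 (Fin n)} (he : e ∈ (mkG n R).edgeSet) :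
    ∃ u v : Fin n, u < v ∧ e = s(u, v) ∧ R u v := by
  induction e using Sym2.ind with
  | _ u v =>
    rw [SimpleGraph.mem_edgeSet] at he
    rcases lt_or_gt_of_ne he.ne with h | h
    · exact ⟨u, v, h, rfl, (mkG_adj h).1 he⟩
    · exact ⟨v, u, h, Sym2.eq_swap, (mkG_adj h).1 he.symm⟩

lemma edgeCross_rep {n : ℕ} {u v x y : Fin n} (h : EdgeCross par s(u, v) s(x, y)) :
    SegCross (par u) (par v) (par x) (par y) := by
  obtain ⟨a, b, c, d, h1, h2, h⟩ := h
  rw [Sym2.eq_iff] at h1 h2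
  rcases h1 with ⟨rfl, rfl⟩ | ⟨rfl, rfl⟩ <;> rcases h2 with ⟨rfl, rfl⟩ | ⟨rfl, rfl⟩
  · exact h
  · exact seg_comm_right h
  · exact seg_comm_left h
  · exact seg_comm_left (seg_comm_right h)

lemma par_cross_of {n : ℕ} {i j k l : Fin n} (h1 : i < k) (h2 : k < j) (h3 : j < l) :
    SegCross (par i) (par j) (par k) (par l) :=
  seg_cross_of (by exact_mod_cast h1) (by exact_mod_cast h2) (by exact_mod_cast h3)

lemma build (n k : ℕ) (hk : 0 < k) (R : ℕ → ℕ → Prop) (col : ℕ → ℕ → ℕ)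
    (hcol : ∀ a b, a < b → b < n → R a b → col a b < k)
    (hcf : ∀ a b c d, a < c → c < b → b < d → d < n → R a b → R c d → col a b ≠ col c d)
    (hsat : ∀ u v, u < v → v < n → ¬ R u v → ∀ c, c < k → ∃ a b, a < b ∧ b < n ∧ R a b ∧
      col a b = c ∧ ((a < u ∧ u < b ∧ b < v) ∨ (u < a ∧ a < v ∧ v < b)))
    (f : ℕ → ℕ) (hcount : ∀ a, a < n → ((Finset.Ioo a n).filter (R a)).card ≤ f a)
    (hf : 2 * ((∑ a ∈ Finset.range n, f a : ℕ) : ℤ) ≤ ((k : ℤ) + 4) * ((n : ℤ) - 2)) :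
    ∃ (G : SimpleGraph (Fin n)) (p : Fin n → Pt) (φ : Sym2 (Fin n) → Fin k),
      GenPos p ∧ ConvexPos p ∧ CrossingFree G p φ ∧
      PrecoloredSaturated G p φ ∧
      2 * (G.edgeSet.ncard : ℤ) ≤ ((k : ℤ) + 4) * ((n : ℤ) - 2) := by
  refine ⟨mkG n R, par, mkC n k hk col, par_genPos, par_convexPos, ?_, ?_, ?_⟩
  · intro e he e' he' hne hc hx
    obtain ⟨u, v, huv, rfl, hR⟩ := edge_rep he
    obtain ⟨x, y, hxy, rfl, hR'⟩ := edge_rep he'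
    have hc' := congrArg Fin.val hc
    rw [mkC_val huv, mkC_val hxy, Nat.mod_eq_of_lt (hcol _ _ huv v.2 hR),
      Nat.mod_eq_of_lt (hcol _ _ hxy y.2 hR')] at hc'
    rcases cross_imp huv hxy (by rintro ⟨rfl, rfl⟩; exact hne rfl) (edgeCross_rep hx) with
      ⟨a, b, c⟩ | ⟨a, b, c⟩
    · exact hcf _ _ _ _ a b c y.2 hR hR' hc'
    · exact hcf _ _ _ _ a b c v.2 hR' hR hc'.symm
  · have main : ∀ u v : Fin n, u < v → ¬ (mkG n R).Adj u v → ∀ c : Fin k,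
        ¬ CrossingFree (mkG n R ⊔ SimpleGraph.fromEdgeSet {s(u, v)}) par
          (fun e => if e = s(u, v) then c else mkC n k hk col e) := by
      intro u v huv hadj c hcr
      rw [mkG_adj huv] at hadj
      obtain ⟨a, b, hab, hbn, hR, hcc, hx⟩ := hsat u v huv v.2 hadj c c.2
      let a' : Fin n := ⟨a, by omega⟩
      let b' : Fin n := ⟨b, hbn⟩
      have hab' : a' < b' := hab
      have hadj' : (mkG n R).Adj a' b' := (mkG_adj hab').2 hR
      have hne : s(a', b') ≠ s(u, v) := by
        intro h
        rw [Sym2.eq_iff] at h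
        rcases h with ⟨h1, h2⟩ | ⟨h1, h2⟩
        · apply hadj; rw [← h1, ← h2]; exact hR
        · rw [h1, h2] at hab'; exact absurd huv (not_lt.2 hab'.le)
      refine hcr s(a', b') ?_ s(u, v) ?_ hne ?_ ?_
      · rw [SimpleGraph.mem_edgeSet]
        exact Or.inl hadj'
      · rw [SimpleGraph.mem_edgeSet]
        refine Or.inr ?_
        simp [huv.ne]
      · simp only [hne, if_false, if_true]
        apply Fin.ext
        rw [mkC_val hab']
        change col a b % k = c
        rw [hcc, Nat.mod_eq_of_lt c.2]
      · refine ⟨a', b', u, v, rfl, rfl, ?_⟩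
        rcases hx with ⟨h1, h2, h3⟩ | ⟨h1, h2, h3⟩
        · exact par_cross_of (show a' < u from h1) (show u < b' from h2) (show b' < v from h3)
        · exact seg_cross_symm
            (par_cross_of (show u < a' from h1) (show a' < v from h2) (show v < b' from h3))
    intro u v huv hadj c
    rcases lt_or_gt_of_ne huv with h | h
    · convert main u v h hadj c
    · rw [show s(u, v) = s(v, u) from Sym2.eq_swap]
      convert main v u h (fun h => hadj h.symm) c
  · refine le_trans ?_ hf
    have : (mkG n R).edgeSet.ncard ≤ ∑ a ∈ Finset.range n, f a := by
      let S : Finset (Σ _ : ℕ, ℕ) :=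
        (Finset.range n).sigma (fun a => (Finset.Ioo a n).filter (R a))
      have hS : S.card ≤ ∑ a ∈ Finset.range n, f a := by
        rw [Finset.card_sigma]
        exact Finset.sum_le_sum (fun a ha => hcount a (Finset.mem_range.1 ha))
      refine le_trans ?_ hS
      rw [← Set.ncard_coe_finset]
      have hex : ∀ e ∈ (mkG n R).edgeSet, ∃ q : (Σ _ : ℕ, ℕ), q ∈ S ∧
          ∃ u v : Fin n, e = s(u, v) ∧ q = ⟨u, v⟩ := by
        intro e he
        obtain ⟨u, v, huv, rfl, hR⟩ := edge_rep he
        refine ⟨⟨u, v⟩, ?_, u, v, rfl, rfl⟩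
        simp only [S, Finset.mem_sigma, Finset.mem_range, Finset.mem_filter, Finset.mem_Ioo]
        exact ⟨u.2, ⟨huv, v.2⟩, hR⟩
      choose g hg1 hg2 using hex
      refine Set.ncard_le_ncard_of_injOn (fun e => if h : e ∈ (mkG n R).edgeSet then g e h else ⟨0, 0⟩)
        ?_ ?_ (Finset.finite_toSet S)
      · intro e he
        simp only [he, dif_pos]
        exact hg1 e he
      · intro e he e' he' hee
        simp only [he, he', dif_pos] at hee
        obtain ⟨u, v, h1, h2⟩ := hg2 e he
        obtain ⟨u', v', h1', h2'⟩ := hg2 e' he'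
        rw [h2, h2'] at hee
        simp only [Sigma.mk.injEq, heq_eq_eq] at hee
        rw [h1, h1', Fin.ext hee.1, Fin.ext hee.2]
    exact_mod_cast Nat.mul_le_mul_left 2 this

/-- Generic sum bound. -/
lemma sum_f (n m : ℕ) (D : ℕ) (f : ℕ → ℕ) (hm : m + 3 ≤ n)
    (h1 : ∀ a, a < m → f a = n - 1 - a) (hD : f m = D)
    (h2 : ∀ a, m < a → f a = min 2 (n - 1 - a)) :
    2 * ((∑ a ∈ Finset.range n, f a : ℕ) : ℤ)
      = 2 * n * m - m * (m + 1) + 2 * D + 4 * (n - m - 1) - 6 := by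
  have s1 : ∀ j, j ≤ m →
      2 * ((∑ a ∈ Finset.range j, f a : ℕ) : ℤ) = 2 * n * j - j * (j + 1) := by
    intro j
    induction j with
    | zero => simp
    | succ j ih =>
      intro hj
      have ih := ih (by omega)
      rw [Finset.sum_range_succ, h1 j (by omega)]
      have : ((n - 1 - j : ℕ) : ℤ) = n - 1 - j := by omega
      push_cast [this] at ih ⊢
      linarith
  have s2 : ∀ j, m + 1 + j + 2 ≤ n →
      2 * ((∑ a ∈ Finset.range (m + 1 + j), f a : ℕ) : ℤ)
        = 2 * n * m - m * (m + 1) + 2 * D + 4 * j := by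
    intro j
    induction j with
    | zero =>
      intro _
      rw [Nat.add_zero, Finset.sum_range_succ, hD]
      have := s1 m le_rfl
      push_cast at this ⊢
      linarith
    | succ j ih =>
      intro hj
      have ih := ih (by omega)
      rw [← Nat.add_assoc, Finset.sum_range_succ, h2 _ (by omega),
        show min 2 (n - 1 - (m + 1 + j)) = 2 by omega]
      push_cast at ih ⊢
      linarith
  obtain ⟨t, rfl⟩ : ∃ t, n = m + 1 + t + 2 := ⟨n - (m + 3), by omega⟩
  have := s2 t le_rfl
  rw [show m + 1 + t + 2 = (m + 1 + t + 1) + 1 from rfl, Finset.sum_range_succ,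
    Finset.sum_range_succ, h2 _ (by omega), h2 _ (by omega),
    show min 2 (m + 1 + t + 1 + 1 - 1 - (m + 1 + t)) = 1 by omega,
    show min 2 (m + 1 + t + 1 + 1 - 1 - (m + 1 + t + 1)) = 0 by omega]
  push_cast at this ⊢
  linarith

lemma cnt_all (n a : ℕ) (P : ℕ → Prop) : ((Finset.Ioo a n).filter P).card ≤ n - 1 - a := by
  refine (Finset.card_filter_le _ _).trans ?_
  rw [Nat.card_Ioo]; omega

lemma cnt_two (n a : ℕ) (P : ℕ → Prop) (h : ∀ b, a < b → b < n → P b → b ≤ a + 2) :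
    ((Finset.Ioo a n).filter P).card ≤ min 2 (n - 1 - a) := by
  refine le_min ?_ (cnt_all n a P)
  refine (Finset.card_le_card (t := {a + 1, a + 2}) ?_).trans (Finset.card_le_two)
  intro b hb
  simp only [Finset.mem_filter, Finset.mem_Ioo, Finset.mem_insert, Finset.mem_singleton] at hb ⊢
  have := h b hb.1.1 hb.1.2 hb.2
  omega

lemma cnt_odd (n m : ℕ) (P : ℕ → Prop)
    (h : ∀ b, P b → b = m + 1 ∨ b = n - 1 ∨ b % 2 = m % 2) :
    ((Finset.Ioo m n).filter P).card ≤ 2 + (n - 1 - m) / 2 := by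
  have hsub : (Finset.Ioo m n).filter P ⊆
      {m + 1, n - 1} ∪ (Finset.range ((n - 1 - m) / 2)).image (fun j => m + 2 * (j + 1)) := by
    intro b hb
    simp only [Finset.mem_filter, Finset.mem_Ioo, Finset.mem_insert, Finset.mem_singleton,
      Finset.mem_union, Finset.mem_image, Finset.mem_range] at hb ⊢
    rcases h b hb.2 with h | h | h
    · exact Or.inl (Or.inl h)
    · exact Or.inl (Or.inr h)
    · exact Or.inr ⟨(b - m) / 2 - 1, by omega, by omega⟩
  refine (Finset.card_le_card hsub).trans ((Finset.card_union_le _ _).trans ?_)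
  exact Nat.add_le_add Finset.card_le_two (Finset.card_image_le.trans (by simp))

/-- For every `n ≥ 5` and `1 ≤ k ≤ n/2` there is a saturated
precolored convex Θ^k-drawing of a graph on `n` vertices with at most
`(k+4)(n-2)/2` edges. -/
theorem stmt2 (n k : ℕ) (hn : 5 ≤ n) (hk : 1 ≤ k) (hkn : 2 * k ≤ n) :
    ∃ (G : SimpleGraph (Fin n)) (p : Fin n → Pt) (φ : Sym2 (Fin n) → Fin k),
      GenPos p ∧ ConvexPos p ∧ CrossingFree G p φ ∧
      PrecoloredSaturated G p φ ∧
      2 * (G.edgeSet.ncard : ℤ) ≤ ((k : ℤ) + 4) * ((n : ℤ) - 2) := by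
  rcases Nat.even_or_odd' k with ⟨m, rfl | rfl⟩
  · obtain ⟨m, rfl⟩ : ∃ t, m = t + 1 := ⟨m - 1, by omega⟩
    -- even case
    refine build n _ hk (fun a b => a < m + 1 ∨ b ≤ a + 2)
      (fun a b => if a < m + 1 then 2 * a + b % 2 else if b = a + 2 then a % 2 else 0)
      ?_ ?_ ?_ (fun a => if a < m + 1 then n - 1 - a else min 2 (n - 1 - a)) ?_ ?_
    · intro a b _ _ _
      split_ifs <;> omega
    · intro a b c d h1 h2 h3 h4 r1 r2
      split_ifs <;> omega
    · intro u v huv hv hR c hc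
      by_cases hp : (u + 1) % 2 = c % 2
      · refine ⟨c / 2, u + 1, by omega, by omega, by omega, ?_, by omega⟩
        rw [if_pos (by omega)]; omega
      · refine ⟨c / 2, u + 2, by omega, by omega, by omega, ?_, by omega⟩
        rw [if_pos (by omega)]; omega
    · intro a ha
      split_ifs with h
      · exact cnt_all _ _ _
      · refine cnt_two _ _ _ ?_
        intro b _ _ hb
        omega
    · rw [sum_f n m (n - 1 - m) _ (by omega)]
      · have : ((n - 1 - m : ℕ) : ℤ) = n - 1 - m := by omega
        push_cast [this]
        nlinarith
      · intro a ha; rw [if_pos (by omega)]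
      · simp
      · intro a ha; rw [if_neg (by omega)]
  · rcases Nat.eq_zero_or_pos m with rfl | hm
    · refine build n _ hk (fun a b => a = 0 ∨ b = a + 1) (fun _ _ => 0)
        ?_ ?_ ?_ (fun a => if a = 0 then n - 1 else if a = n - 1 then 0 else 1) ?_ ?_
      · intro a b _ _ _; simp
      · intro a b c d h1 h2 h3 h4 r1 r2; omega
      · intro u v huv hv hR c hc
        exact ⟨0, u + 1, by omega, by omega, by omega, by omega, by omega⟩
      · intro a ha
        split_ifs with h h'
        · subst h; exact cnt_all _ _ _
        · subst h'
          have := cnt_all n (n - 1) (fun b => n - 1 = 0 ∨ b = n - 1 + 1)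
          omega
        · refine (Finset.card_le_card (t := {a + 1}) ?_).trans (by simp)
          intro b hb
          simp only [Finset.mem_filter, Finset.mem_singleton] at hb ⊢
          omega
      · obtain ⟨t, rfl⟩ : ∃ t, n = t + 2 := ⟨n - 2, by omega⟩
        have key : (∑ a ∈ Finset.range (t + 2),
            (if a = 0 then t + 2 - 1 else if a = t + 2 - 1 then 0 else 1)) = t + (t + 1) := by
          rw [Finset.sum_range_succ, Finset.sum_range_succ']
          have : ∀ a ∈ Finset.range t, (if a + 1 = 0 then t + 2 - 1
              else if a + 1 = t + 2 - 1 then 0 else 1) = 1 := by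
            intro a ha
            rw [Finset.mem_range] at ha
            rw [if_neg (by omega), if_neg (by omega)]
          rw [Finset.sum_congr rfl this]
          simp
        rw [key]
        push_cast
        have : (5 : ℤ) ≤ t + 2 := by exact_mod_cast hn
        linarith
    · refine build n _ hk
        (fun a b => a < m ∨ (a = m ∧ (b = m + 1 ∨ b = n - 1 ∨ b % 2 = m % 2)) ∨
          (m < a ∧ b ≤ a + 2))
        (fun a b => if a < m then 2 * a + b % 2 else if a = m then 2 * m else
          if b = a + 2 then (if a % 2 = m % 2 then 2 * m else a % 2) else 0)
        ?_ ?_ ?_ (fun a => if a < m then n - 1 - a else if a = m then 2 + (n - 1 - m) / 2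
          else min 2 (n - 1 - a)) ?_ ?_
      · intro a b _ _ _
        split_ifs <;> omega
      · intro a b c d h1 h2 h3 h4 r1 r2
        split_ifs <;> omega
      · intro u v huv hv hR c hc
        by_cases hcm : c = 2 * m
        · by_cases hu : u = m
          · refine ⟨v - 1, v + 1, by omega, by omega, by omega, ?_, by omega⟩
            rw [if_neg (by omega), if_neg (by omega), if_pos (by omega), if_pos (by omega)]
            omega
          · by_cases hp : (u + 1) % 2 = m % 2
            · refine ⟨m, u + 1, by omega, by omega, by omega, ?_, by omega⟩
              rw [if_neg (by omega), if_pos rfl]; omega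
            · refine ⟨m, u + 2, by omega, by omega, by omega, ?_, by omega⟩
              rw [if_neg (by omega), if_pos rfl]; omega
        · by_cases hp : (u + 1) % 2 = c % 2
          · refine ⟨c / 2, u + 1, by omega, by omega, by omega, ?_, by omega⟩
            rw [if_pos (by omega)]; omega
          · refine ⟨c / 2, u + 2, by omega, by omega, by omega, ?_, by omega⟩
            rw [if_pos (by omega)]; omega
      · intro a ha
        split_ifs with h h'
        · exact cnt_all _ _ _
        · subst h'
          refine cnt_odd _ _ _ ?_
          intro b hb
          omega
        · refine cnt_two _ _ _ ?_
          intro b _ _ hb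
          omega
      · rw [sum_f n m (2 + (n - 1 - m) / 2) _ (by omega)]
        · have : 2 * ((2 + (n - 1 - m) / 2 : ℕ) : ℤ) ≤ 4 + (n - 1 - m) := by omega
          push_cast at this ⊢
          have hm' : (1 : ℤ) ≤ m := by exact_mod_cast hm
          nlinarith
        · intro a ha; rw [if_pos (by omega)]
        · simp
        · intro a ha; rw [if_neg (by omega), if_neg (by omega)]
end

section
/- Every saturated precolored convex Θ^2-drawing of a graph G on n ≥ 3 vertices has exactly 3n − 6 edges. -/
open scoped Classical

/-- Interleaving of index pairs. -/
def Intlv (a b c d : ℕ) : Prop := (a < c ∧ c < b ∧ b < d) ∨ (c < a ∧ a < d ∧ d < b)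

lemma comb_mid (n : ℕ) (S : Finset (ℕ × ℕ))
    (hlt : ∀ a b, (a, b) ∈ S → a < b ∧ b < n)
    (hcons : ∀ i, i + 1 < n → (i, i + 1) ∈ S)
    (hnc : ∀ a b c d, (a, b) ∈ S → (c, d) ∈ S → ¬ Intlv a b c d)
    (hmax : ∀ a c d e, a < c → c < d → d < e → e < n →
      ∃ x y, (x, y) ∈ S ∧ (Intlv a d x y ∨ Intlv c e x y))
    (a b : ℕ) (hab : (a, b) ∈ S) (h2 : a + 2 ≤ b) :
    ∃ c, a < c ∧ c < b ∧ (a, c) ∈ S ∧ (c, b) ∈ S := by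
  have hbn := (hlt a b hab).2
  have key : ∀ (u v : ℕ), a ≤ u → u < v → v ≤ b → (u, v) ∈ S →
      ∃ c, u < c ∧ c ≤ v ∧ (u, c) ∈ S := fun u v _ h _ h' => ⟨v, h, le_rfl, h'⟩
  have mx : ∀ (u m : ℕ), u + 1 ≤ m → m < n →
      ∃ c, u < c ∧ c ≤ m ∧ (u, c) ∈ S ∧ ∀ y, c < y → y ≤ m → (u, y) ∉ S := by
    intro u m hum hm
    have hne : ((Finset.Icc (u+1) m).filter (fun c => (u, c) ∈ S)).Nonempty :=
      ⟨u+1, by simp only [Finset.mem_filter, Finset.mem_Icc]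
               exact ⟨⟨le_rfl, hum⟩, hcons u (by omega)⟩⟩
    obtain ⟨c, hc, hc'⟩ := Finset.exists_max_image _ id hne
    simp only [Finset.mem_filter, Finset.mem_Icc, id] at hc hc'
    refine ⟨c, by omega, hc.1.2, hc.2, fun y hy hym hS => ?_⟩
    have := hc' y ⟨⟨by omega, hym⟩, hS⟩
    omega
  obtain ⟨c, hac, hcb, hcS, hcm⟩ := mx a (b-1) (by omega) (by omega)
  obtain ⟨d, hcd, hdb, hdS, hdm⟩ := mx c b (by omega) (by omega)
  by_cases hd : d = b
  · exact ⟨c, hac, by omega, hcS, hd ▸ hdS⟩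
  obtain ⟨e, hde, heb, heS, hem⟩ := mx d b (by omega) (by omega)
  exfalso
  obtain ⟨x, y, hxy, h⟩ := hmax a c d e hac hcd hde (by omega)
  have h1 := hnc a b x y hab hxy
  have h2 := hnc a c x y hcS hxy
  have h3 := hnc c d x y hdS hxy
  have h4 := hnc d e x y heS hxy
  have h0 := hlt x y hxy
  unfold Intlv at *
  by_cases hxa : x = a
  · subst hxa
    by_cases hy : y ≤ b - 1
    · by_cases hy' : c < y
      · exact hcm y hy' hy hxy
      · omega
    · omega
  by_cases hxc : x = c
  · subst hxc
    by_cases hy : y ≤ b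
    · by_cases hy' : d < y
      · exact hdm y hy' hy hxy
      · omega
    · omega
  by_cases hxd : x = d
  · subst hxd
    by_cases hy : y ≤ b
    · by_cases hy' : e < y
      · exact hem y hy' hy hxy
      · omega
    · omega
  omega

lemma comb_count (n : ℕ) (S : Finset (ℕ × ℕ))
    (hlt : ∀ a b, (a, b) ∈ S → a < b ∧ b < n)
    (hcons : ∀ i, i + 1 < n → (i, i + 1) ∈ S)
    (hnc : ∀ a b c d, (a, b) ∈ S → (c, d) ∈ S → ¬ Intlv a b c d)
    (hmax : ∀ a c d e, a < c → c < d → d < e → e < n →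
      ∃ x y, (x, y) ∈ S ∧ (Intlv a d x y ∨ Intlv c e x y)) :
    ∀ (m a b : ℕ), b - a ≤ m → (a, b) ∈ S →
      (S.filter (fun x => a ≤ x.1 ∧ x.2 ≤ b)).card + 1 = 2 * (b - a) := by
  intro m
  induction m with
  | zero => intro a b h hab; have := hlt a b hab; omega
  | succ m ih =>
    intro a b hm hab
    have h0 := hlt a b hab
    by_cases h1 : b = a + 1
    · have : S.filter (fun x => a ≤ x.1 ∧ x.2 ≤ b) = {(a, b)} := by
        ext ⟨x, y⟩
        simp only [Finset.mem_filter, Finset.mem_singleton, Prod.mk.injEq]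
        constructor
        · rintro ⟨h, h'⟩
          have := hlt x y h
          omega
        · rintro ⟨rfl, rfl⟩
          exact ⟨hab, le_rfl, le_rfl⟩
      rw [this, Finset.card_singleton]
      omega
    · obtain ⟨c, hac, hcb, hc1, hc2⟩ := comb_mid n S hlt hcons hnc hmax a b hab (by omega)
      have i1 := ih a c (by omega) hc1
      have i2 := ih c b (by omega) hc2
      have : S.filter (fun x => a ≤ x.1 ∧ x.2 ≤ b) =
          insert (a, b) (S.filter (fun x => a ≤ x.1 ∧ x.2 ≤ c) ∪
            S.filter (fun x => c ≤ x.1 ∧ x.2 ≤ b)) := by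
        ext ⟨x, y⟩
        simp only [Finset.mem_filter, Finset.mem_insert, Finset.mem_union, Prod.mk.injEq]
        constructor
        · rintro ⟨h, h'⟩
          have := hlt x y h
          have k1 := hnc a c x y hc1 h
          have k2 := hnc c b x y hc2 h
          unfold Intlv at k1 k2
          simp only [h, true_and]
          omega
        · rintro (⟨rfl, rfl⟩ | ⟨h, h'⟩ | ⟨h, h'⟩)
          · exact ⟨hab, le_rfl, le_rfl⟩
          · exact ⟨h, by omega⟩
          · exact ⟨h, by omega⟩
      rw [this, Finset.card_insert_of_notMem, Finset.card_union_of_disjoint]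
      · omega
      · rw [Finset.disjoint_left]
        rintro ⟨x, y⟩ h h'
        simp only [Finset.mem_filter] at h h'
        have := hlt x y h.1
        omega
      · simp only [Finset.mem_filter, Finset.mem_union]
        omega

lemma comb (n : ℕ) (hn : 2 ≤ n) (S : Finset (ℕ × ℕ))
    (hlt : ∀ a b, (a, b) ∈ S → a < b ∧ b < n)
    (hcons : ∀ i, i + 1 < n → (i, i + 1) ∈ S)
    (h0 : (0, n - 1) ∈ S)
    (hnc : ∀ a b c d, (a, b) ∈ S → (c, d) ∈ S → ¬ Intlv a b c d)
    (hmax : ∀ a c d e, a < c → c < d → d < e → e < n →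
      ∃ x y, (x, y) ∈ S ∧ (Intlv a d x y ∨ Intlv c e x y)) :
    S.card + 3 = 2 * n := by
  have := comb_count n S hlt hcons hnc hmax n 0 (n-1) (by omega) h0
  rw [Finset.filter_true_of_mem] at this
  · omega
  · rintro ⟨x, y⟩ h
    have := hlt x y h
    simp only
    omega

lemma det2_ne {V : Type} {p : V → Pt} (hgen : GenPos p) (u v w : V)
    (h1 : u ≠ v) (h2 : u ≠ w) (h3 : v ≠ w) : det2 (p u) (p v) (p w) ≠ 0 := by
  intro h
  apply hgen.2 u v w h1 h2 h3
  have hne : p v ≠ p u := fun h => h1 (hgen.1 h).symm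
  rw [collinear_iff_of_mem (p₀ := p u) (by simp)]
  refine ⟨p v - p u, ?_⟩
  have hw : ∃ r : ℝ, p w = r • (p v - p u) + p u := by
    unfold det2 at h
    by_cases hx : (p v).1 - (p u).1 = 0
    · have hy : (p v).2 - (p u).2 ≠ 0 := by
        intro hy
        exact hne (Prod.ext (by linarith) (by linarith))
      refine ⟨((p w).2 - (p u).2) / ((p v).2 - (p u).2), Prod.ext ?_ ?_⟩
      · simp only [Prod.fst_add, Prod.smul_fst, Prod.fst_sub, smul_eq_mul]
        rw [hx] at h ⊢
        have : ((p v).2 - (p u).2) * ((p w).1 - (p u).1) = 0 := by linarith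
        rcases mul_eq_zero.1 this with h | h
        · exact absurd h hy
        · linarith
      · simp only [Prod.snd_add, Prod.smul_snd, Prod.snd_sub, smul_eq_mul]
        field_simp
        ring
    · refine ⟨((p w).1 - (p u).1) / ((p v).1 - (p u).1), Prod.ext ?_ ?_⟩
      · simp only [Prod.fst_add, Prod.smul_fst, Prod.fst_sub, smul_eq_mul]
        field_simp
        ring
      · simp only [Prod.snd_add, Prod.smul_snd, Prod.snd_sub, smul_eq_mul]
        field_simp
        linarith
  intro q hq
  simp only [Set.mem_insert_iff, Set.mem_singleton_iff] at hq
  rcases hq with rfl | rfl | rfl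
  · exact ⟨0, by simp⟩
  · exact ⟨1, by simp⟩
  · simpa using hw

lemma no_cyc {V : Type} {p : V → Pt} (hgen : GenPos p) (hconv : ConvexPos p) (j a b c : V)
    (hja : j ≠ a)
    (h1 : 0 < det2 (p j) (p a) (p b)) (h2 : 0 < det2 (p j) (p b) (p c))
    (h3 : 0 < det2 (p j) (p c) (p a)) : False := by
  set γ := det2 (p j) (p a) (p b) with hγ
  set α := det2 (p j) (p b) (p c) with hα
  set β := det2 (p j) (p c) (p a) with hβ
  have hx : (α + β + γ) * (p j).1 = α * (p a).1 + β * (p b).1 + γ * (p c).1 := by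
    rw [hγ, hα, hβ]; unfold det2; ring
  have hy : (α + β + γ) * (p j).2 = α * (p a).2 + β * (p b).2 + γ * (p c).2 := by
    rw [hγ, hα, hβ]; unfold det2; ring
  have hs : ∀ v, p v ∈ convexHull ℝ (Set.range p) :=
    fun v => subset_convexHull ℝ _ ⟨v, rfl⟩
  have hm : (β / (β + γ)) • p b + (γ / (β + γ)) • p c ∈ convexHull ℝ (Set.range p) := by
    apply convex_convexHull ℝ _ (hs b) (hs c) (by positivity) (by positivity)
    field_simp
  have hj := hconv j
  rw [mem_extremePoints] at hj
  have := hj.2 _ (hs a) _ hm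
    ⟨α / (α + β + γ), (β + γ) / (α + β + γ), by positivity, by positivity, by field_simp; ring, by
      apply Prod.ext
      · simp only [Prod.fst_add, Prod.smul_fst, smul_eq_mul]
        field_simp
        linarith
      · simp only [Prod.snd_add, Prod.smul_snd, smul_eq_mul]
        field_simp
        linarith⟩
  exact hja (hgen.1 this.1).symm

lemma exists_enum {V : Type} [Fintype V] [Nonempty V] (n : ℕ) (hV : Fintype.card V = n)
    (lt : V → V → Prop)
    (hirr : ∀ a, ¬ lt a a) (htr : ∀ a b c, lt a b → lt b c → lt a c)
    (htot : ∀ a b, a ≠ b → lt a b ∨ lt b a) :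
    ∃ q : ℕ → V, (∀ v, ∃ i < n, q i = v) ∧ (∀ i j, i < j → j < n → lt (q i) (q j)) := by
  haveI : IsStrictTotalOrder V lt :=
    { irrefl := hirr, trans := htr
      trichotomous := fun a b h1 h2 => by
        by_contra h
        rcases htot a b h with h | h
        · exact h1 h
        · exact h2 h }
  letI : LinearOrder V := linearOrderOfSTO lt
  let e := Fintype.orderIsoFinOfCardEq V hV
  refine ⟨fun i => if h : i < n then e ⟨i, h⟩ else Classical.arbitrary V, ?_, ?_⟩
  · intro v
    refine ⟨(e.symm v).1, (e.symm v).2, ?_⟩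
    simp
  · intro i j hij hj
    have hi : i < n := by omega
    simp only [hi, hj, dif_pos]
    have : e ⟨i, hi⟩ < e ⟨j, hj⟩ := e.lt_iff_lt.2 hij
    exact this

lemma det2_rot (a b c : Pt) : det2 a b c = det2 b c a := by unfold det2; ring
lemma det2_swap (a b c : Pt) : det2 a b c = - det2 a c b := by unfold det2; ring

lemma exists_order (n : ℕ) (hn : 3 ≤ n) (p : Fin n → Pt) (hgen : GenPos p) (hconv : ConvexPos p) :
    ∃ q : ℕ → Fin n, (∀ v, ∃ i < n, q i = v) ∧ (∀ i j, i < j → j < n → q i ≠ q j) ∧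
      ∀ i j k, i < j → j < k → k < n → 0 < det2 (p (q i)) (p (q j)) (p (q k)) := by
  let o : Fin n := ⟨0, by omega⟩
  haveI : Nonempty (Fin n) := ⟨o⟩
  let lt : Fin n → Fin n → Prop := fun u w =>
    w ≠ o ∧ (u = o ∨ 0 < det2 (p o) (p u) (p w))
  have dself : ∀ a b : Pt, det2 a b b = 0 := fun a b => by unfold det2; ring
  have dself' : ∀ a b : Pt, det2 a a b = 0 := fun a b => by unfold det2; ring
  have hirr : ∀ a, ¬ lt a a := by
    rintro a ⟨h, h' | h'⟩
    · exact h h'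
    · rw [dself] at h'; exact lt_irrefl _ h'
  have htr : ∀ a b c, lt a b → lt b c → lt a c := by
    rintro a b c ⟨hb, hab⟩ ⟨hc, hbc⟩
    refine ⟨hc, ?_⟩
    by_cases ha : a = o
    · exact Or.inl ha
    right
    have h1 := hab.resolve_left ha
    have h2 := hbc.resolve_left hb
    by_contra h3
    have hac : a ≠ c := by
      rintro rfl
      rw [det2_swap] at h2
      linarith
    have h4 := det2_ne hgen o a c (Ne.symm ha) (Ne.symm hc) hac
    have h5 : 0 < det2 (p o) (p c) (p a) := by
      rw [det2_swap]
      have := lt_of_le_of_ne (not_lt.1 h3) h4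
      linarith
    exact no_cyc hgen hconv o a b c (Ne.symm ha) h1 h2 h5
  have htot : ∀ a b, a ≠ b → lt a b ∨ lt b a := by
    intro a b hab
    by_cases ha : a = o
    · exact Or.inl ⟨fun h => hab (ha.trans h.symm), Or.inl ha⟩
    by_cases hb : b = o
    · exact Or.inr ⟨ha, Or.inl hb⟩
    rcases lt_or_gt_of_ne (det2_ne hgen o a b (Ne.symm ha) (Ne.symm hb) hab) with h | h
    · right
      refine ⟨ha, Or.inr ?_⟩
      rw [det2_swap]; linarith
    · exact Or.inl ⟨hb, Or.inr h⟩
  obtain ⟨q, hq1, hq2⟩ := exists_enum n (by simp) lt hirr htr htot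
  refine ⟨q, hq1, ?_, ?_⟩
  · intro i j hij hj h
    have := hq2 i j hij hj
    rw [h] at this
    exact hirr _ this
  · intro i j k hij hjk hk
    obtain ⟨hj, h1⟩ := hq2 i j hij (by omega)
    obtain ⟨hk', h2⟩ := hq2 j k hjk hk
    obtain ⟨_, h3⟩ := hq2 i k (by omega) hk
    have hne : ∀ i j, i < j → j < n → q i ≠ q j := by
      intro i j hij hj h
      have := hq2 i j hij hj
      rw [h] at this
      exact hirr _ this
    have h2 := h2.resolve_left hj
    by_cases hi : q i = o
    · rw [hi]; exact h2
    have h1 := h1.resolve_left hi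
    have h3 := h3.resolve_left hi
    by_contra h4
    have h5 := det2_ne hgen _ _ _ (hne i j hij (by omega)) (hne i k (by omega) hk) (hne j k hjk hk)
    have h6 := lt_of_le_of_ne (not_lt.1 h4) h5
    refine no_cyc hgen hconv (q j) o (q i) (q k) hj ?_ ?_ ?_
    · rw [det2_rot]; exact h1
    · rw [det2_rot, det2_rot, det2_swap] at h6
      rw [det2_rot, det2_rot] at h6
      have e : det2 (p (q j)) (p (q i)) (p (q k)) = - det2 (p (q i)) (p (q j)) (p (q k)) := by
        unfold det2; ring
      rw [e]
      have := lt_of_le_of_ne (not_lt.1 h4) h5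
      linarith
    · rw [← det2_rot]; exact h2

lemma segCross_comm (a b c d : Pt) (h : SegCross a b c d) : SegCross c d a b := by
  obtain ⟨x, h1, h2⟩ := h
  exact ⟨x, h2, h1⟩

lemma segCross_swapl (a b c d : Pt) (h : SegCross a b c d) : SegCross b a c d := by
  obtain ⟨x, h1, h2⟩ := h
  exact ⟨x, by rwa [openSegment_symm], h2⟩

lemma segCross_swapr (a b c d : Pt) (h : SegCross a b c d) : SegCross a b d c :=
  segCross_comm _ _ _ _ (segCross_swapl _ _ _ _ (segCross_comm _ _ _ _ h))

lemma edgeCross_comm {V : Type} {p : V → Pt} {e f : Sym2 V} (h : EdgeCross p e f) :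
    EdgeCross p f e := by
  obtain ⟨u, v, x, y, h1, h2, h3⟩ := h
  exact ⟨x, y, u, v, h2, h1, segCross_comm _ _ _ _ h3⟩

lemma edgeCross_mk {V : Type} {p : V → Pt} {a b c d : V} (h : EdgeCross p s(a, b) s(c, d)) :
    SegCross (p a) (p b) (p c) (p d) := by
  obtain ⟨u, v, x, y, h1, h2, h3⟩ := h
  rw [Sym2.eq_iff] at h1 h2
  rcases h1 with ⟨rfl, rfl⟩ | ⟨rfl, rfl⟩ <;> rcases h2 with ⟨rfl, rfl⟩ | ⟨rfl, rfl⟩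
  · exact h3
  · exact segCross_swapr _ _ _ _ h3
  · exact segCross_swapl _ _ _ _ h3
  · exact segCross_swapl _ _ _ _ (segCross_swapr _ _ _ _ h3)

/-- Crossing segments of a convex quadrilateral. -/
lemma segCross_of_det (a b c d : Pt) (h1 : 0 < det2 a b c) (h2 : 0 < det2 a c d)
    (h3 : 0 < det2 a b d) (h4 : 0 < det2 b c d) : SegCross a c b d := by
  set α := det2 a b c with hα
  set β := det2 a c d with hβ
  set γ := det2 a b d with hγ
  set δ := det2 b c d with hδ
  have hs : α + β = γ + δ := by rw [hα, hβ, hγ, hδ]; unfold det2; ring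
  have hx : δ * a.1 + γ * c.1 = β * b.1 + α * d.1 := by
    rw [hα, hβ, hγ, hδ]; unfold det2; ring
  have hy : δ * a.2 + γ * c.2 = β * b.2 + α * d.2 := by
    rw [hα, hβ, hγ, hδ]; unfold det2; ring
  refine ⟨(δ / (α + β)) • a + (γ / (α + β)) • c,
    ⟨_, _, by positivity, by positivity, by field_simp; linarith, rfl⟩,
    ⟨β / (α + β), α / (α + β), by positivity, by positivity, by field_simp; ring, ?_⟩⟩
  apply Prod.ext
  · simp only [Prod.fst_add, Prod.smul_fst, smul_eq_mul]
    field_simp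
    linarith
  · simp only [Prod.snd_add, Prod.smul_snd, smul_eq_mul]
    field_simp
    linarith

lemma det_of_segCross (a b c d : Pt) (h : SegCross a b c d) :
    ∃ s t : ℝ, 0 < s ∧ 0 < t ∧ s * det2 a b c + t * det2 a b d = 0 := by
  obtain ⟨x, ⟨u, v, hu, hv, huv, rfl⟩, ⟨s, t, hs, ht, hst, hx⟩⟩ := h
  refine ⟨s, t, hs, ht, ?_⟩
  have e1 := congrArg Prod.fst hx
  have e2 := congrArg Prod.snd hx
  simp only [Prod.fst_add, Prod.smul_fst, smul_eq_mul, Prod.snd_add, Prod.smul_snd] at e1 e2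
  have hs' : s = 1 - t := by linarith
  have hu' : u = 1 - v := by linarith
  subst hs' hu'
  unfold det2
  linear_combination (b.1 - a.1) * e2 - (b.2 - a.2) * e1

lemma inter_iff {n : ℕ} {p : Fin n → Pt} {q : ℕ → Fin n}
    (hq : ∀ i j k, i < j → j < k → k < n → 0 < det2 (p (q i)) (p (q j)) (p (q k)))
    (i j k l : ℕ) (hij : i < j) (hj : j < n) (hkl : k < l) (hl : l < n)
    (hne : ¬ (i = k ∧ j = l)) :
    EdgeCross p s(q i, q j) s(q k, q l) ↔ Intlv i j k l := by
  constructor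
  · intro h
    obtain ⟨s, t, hs, ht, hst⟩ := det_of_segCross _ _ _ _ (edgeCross_mk h)
    have hin : ∀ m, i < m → m < j → det2 (p (q i)) (p (q j)) (p (q m)) < 0 := by
      intro m h1 h2
      have := hq i m j h1 h2 hj
      rw [det2_swap]; linarith
    have hout : ∀ m, m < n → (m < i ∨ j < m) → 0 < det2 (p (q i)) (p (q j)) (p (q m)) := by
      rintro m hm (h | h)
      · rw [← det2_rot]; exact hq m i j h hij hj
      · exact hq i j m hij h hm
    have h0 : ∀ m, m = i ∨ m = j → det2 (p (q i)) (p (q j)) (p (q m)) = 0 := by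
      rintro m (rfl | rfl) <;> unfold det2 <;> ring
    have tri : ∀ m, m < n → (i < m ∧ m < j) ∨ (m < i ∨ j < m) ∨ (m = i ∨ m = j) := by omega
    by_contra hI
    unfold Intlv at hI
    rcases tri k (by omega) with hk | hk | hk <;> rcases tri l hl with hl' | hl' | hl'
    · nlinarith [hin k hk.1 hk.2, hin l hl'.1 hl'.2]
    · omega
    · rw [h0 l hl'] at hst
      nlinarith [hin k hk.1 hk.2]
    · omega
    · nlinarith [hout k (by omega) hk, hout l hl hl']
    · rw [h0 l hl'] at hst
      nlinarith [hout k (by omega) hk]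
    · rw [h0 k hk] at hst
      nlinarith [hin l hl'.1 hl'.2]
    · rw [h0 k hk] at hst
      nlinarith [hout l hl hl']
    · omega
  · rintro (⟨h1, h2, h3⟩ | ⟨h1, h2, h3⟩)
    · exact ⟨_, _, _, _, rfl, rfl, segCross_of_det _ _ _ _ (hq _ _ _ h1 h2 hj)
        (hq _ _ _ hij h3 hl) (hq _ _ _ h1 hkl hl) (hq _ _ _ h2 h3 hl)⟩
    · exact ⟨_, _, _, _, rfl, rfl, segCross_comm _ _ _ _ (segCross_of_det _ _ _ _ (hq _ _ _ h1 h2 hl)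
        (hq _ _ _ hkl h3 hj) (hq _ _ _ h1 hij hj) (hq _ _ _ h2 h3 hj))⟩

lemma sat_cross {n : ℕ} {G : SimpleGraph (Fin n)} {p : Fin n → Pt} {φ : Sym2 (Fin n) → Fin 2}
    (hφ : CrossingFree G p φ) (hsat : PrecoloredSaturated G p φ) (u v : Fin n) (huv : u ≠ v)
    (hadj : ¬ G.Adj u v) (c : Fin 2) :
    ∃ f ∈ G.edgeSet, φ f = c ∧ EdgeCross p s(u, v) f := by
  by_contra hcon
  push Not at hcon
  apply hsat u v huv hadj c
  have hmem : ∀ e ∈ (G ⊔ SimpleGraph.fromEdgeSet {s(u, v)}).edgeSet, e ≠ s(u, v) →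
      e ∈ G.edgeSet := by
    intro e he hne
    rw [SimpleGraph.edgeSet_sup, SimpleGraph.edgeSet_fromEdgeSet] at he
    rcases he with he | he
    · exact he
    · exact absurd he.1 hne
  intro e he f hf hef hc hcr
  by_cases h1 : e = s(u, v)
  · have h2 : f ≠ s(u, v) := fun h => hef (h1.trans h.symm)
    simp only [h1, h2, if_true, if_false] at hc
    exact hcon f (hmem f hf h2) hc.symm (h1 ▸ hcr)
  · by_cases h2 : f = s(u, v)
    · simp only [h1, h2, if_true, if_false] at hc
      exact hcon e (hmem e he h1) hc (edgeCross_comm (h2 ▸ hcr))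
    · simp only [h1, h2, if_false] at hc
      exact hφ e (hmem e he h1) f (hmem f hf h2) hef hc hcr

/-- Outer index pairs. -/
def OuterP (n i j : ℕ) : Prop := j = i + 1 ∨ (i = 0 ∧ j = n - 1)

/-- Index pairs -/
noncomputable def pairsF (n : ℕ) (P : ℕ → ℕ → Prop) : Finset (ℕ × ℕ) :=
  (Finset.range n ×ˢ Finset.range n).filter (fun x => x.1 < x.2 ∧ P x.1 x.2)

lemma mem_pairsF (n : ℕ) (P : ℕ → ℕ → Prop) (i j : ℕ) :
    (i, j) ∈ pairsF n P ↔ i < j ∧ j < n ∧ P i j := by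
  unfold pairsF
  simp only [Finset.mem_filter, Finset.mem_product, Finset.mem_range]
  constructor
  · rintro ⟨⟨h1, h2⟩, h3, h4⟩; exact ⟨h3, h2, h4⟩
  · rintro ⟨h1, h2, h3⟩; exact ⟨⟨by omega, h2⟩, h1, h3⟩

lemma card_outer (n : ℕ) (hn : 3 ≤ n) : (pairsF n (OuterP n)).card = n := by
  have : pairsF n (OuterP n) =
      insert (0, n - 1) ((Finset.range (n - 1)).image (fun i => (i, i + 1))) := by
    ext ⟨i, j⟩
    rw [mem_pairsF]
    simp only [OuterP, Finset.mem_insert, Finset.mem_image, Finset.mem_range, Prod.mk.injEq]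
    constructor
    · rintro ⟨h1, h2, h | h⟩
      · exact Or.inr ⟨i, by omega, rfl, h.symm⟩
      · exact Or.inl h
    · rintro (h | ⟨a, h1, h2, h3⟩) <;> omega
  rw [this, Finset.card_insert_of_notMem, Finset.card_image_of_injective, Finset.card_range]
  · omega
  · intro a b h
    simpa using congrArg Prod.fst h
  · simp only [Finset.mem_image, Finset.mem_range, Prod.mk.injEq]
    omega

/-- Every saturated precolored convex Θ^2-drawing of a graph on
`n ≥ 3` vertices has exactly `3n - 6` edges. -/
theorem stmt4 (n : ℕ) (hn : 3 ≤ n)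
    (G : SimpleGraph (Fin n)) (p : Fin n → Pt) (φ : Sym2 (Fin n) → Fin 2)
    (hgen : GenPos p) (hconv : ConvexPos p)
    (hφ : CrossingFree G p φ) (hsat : PrecoloredSaturated G p φ) :
    (G.edgeSet.ncard : ℤ) = 3 * (n : ℤ) - 6 := by
  obtain ⟨q, hsurj, hinj, hq⟩ := exists_order n hn p hgen hconv
  have hinj' : ∀ i j, i < n → j < n → q i = q j → i = j := by
    intro i j hi hj h
    rcases lt_trichotomy i j with h' | h' | h'
    · exact absurd h (hinj i j h' hj)
    · exact h'
    · exact absurd h.symm (hinj j i h' hi)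
  have hrep : ∀ f ∈ G.edgeSet, ∃ k l, k < l ∧ l < n ∧ f = s(q k, q l) := by
    intro f
    induction f with
    | h x y =>
      intro hf
      obtain ⟨k, hk, rfl⟩ := hsurj x
      obtain ⟨l, hl, rfl⟩ := hsurj y
      rcases lt_trichotomy k l with h | h | h
      · exact ⟨k, l, h, hl, rfl⟩
      · subst h
        exact absurd hf (G.loopless.irrefl _)
      · exact ⟨l, k, h, hk, Sym2.eq_swap⟩
  have hs : ∀ i j k l, i < j → j < n → k < l → l < n → s(q i, q j) = s(q k, q l) →
      i = k ∧ j = l := by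
    intro i j k l hij hj hkl hl h
    rw [Sym2.eq_iff] at h
    rcases h with ⟨h1, h2⟩ | ⟨h1, h2⟩
    · exact ⟨hinj' _ _ (by omega) (by omega) h1, hinj' _ _ (by omega) (by omega) h2⟩
    · have := hinj' _ _ (by omega) (by omega) h1
      have := hinj' _ _ (by omega) (by omega) h2
      omega
  have hsat' : ∀ i j, i < j → j < n → ¬ G.Adj (q i) (q j) → ∀ c : Fin 2,
      ∃ k l, k < l ∧ l < n ∧ G.Adj (q k) (q l) ∧ φ s(q k, q l) = c ∧ Intlv i j k l := by
    intro i j hij hj hadj c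
    obtain ⟨f, hf, hc, hcr⟩ := sat_cross hφ hsat _ _ (hinj i j hij hj) hadj c
    obtain ⟨k, l, hkl, hl, rfl⟩ := hrep f hf
    refine ⟨k, l, hkl, hl, hf, hc, ?_⟩
    refine (inter_iff hq i j k l hij hj hkl hl ?_).1 hcr
    rintro ⟨rfl, rfl⟩
    exact hadj hf
  have hnc : ∀ i j k l, i < j → j < n → k < l → l < n → G.Adj (q i) (q j) → G.Adj (q k) (q l) →
      φ s(q i, q j) = φ s(q k, q l) → ¬ Intlv i j k l := by
    intro i j k l hij hj hkl hl h1 h2 hc hI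
    have hne : ¬ (i = k ∧ j = l) := by unfold Intlv at hI; omega
    refine hφ _ h1 _ h2 (fun h => hne (hs i j k l hij hj hkl hl h)) hc ?_
    exact (inter_iff hq i j k l hij hj hkl hl hne).2 hI
  have hout : ∀ i j, i < j → j < n → OuterP n i j → G.Adj (q i) (q j) := by
    intro i j hij hj ho
    by_contra h
    obtain ⟨k, l, hkl, hl, _, _, hI⟩ := hsat' i j hij hj h 0
    unfold Intlv at hI
    unfold OuterP at ho
    omega
  let R : Fin 2 → Finset (ℕ × ℕ) := fun c =>
    pairsF n (fun i j => OuterP n i j ∨ (G.Adj (q i) (q j) ∧ φ s(q i, q j) = c))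
  have hR : ∀ c, (R c).card + 3 = 2 * n := by
    intro c
    apply comb n (by omega)
    · intro a b h
      have := (mem_pairsF _ _ _ _).1 h
      exact ⟨this.1, this.2.1⟩
    · intro i hi
      exact (mem_pairsF _ _ _ _).2 ⟨by omega, hi, Or.inl (Or.inl rfl)⟩
    · exact (mem_pairsF _ _ _ _).2 ⟨by omega, by omega, Or.inl (Or.inr ⟨rfl, rfl⟩)⟩
    · intro i j k l h1 h2 hI
      obtain ⟨a1, a2, a3⟩ := (mem_pairsF _ _ _ _).1 h1
      obtain ⟨b1, b2, b3⟩ := (mem_pairsF _ _ _ _).1 h2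
      rcases a3 with a3 | a3
      · unfold OuterP at a3; unfold Intlv at hI; omega
      rcases b3 with b3 | b3
      · unfold OuterP at b3; unfold Intlv at hI; omega
      exact hnc i j k l a1 a2 b1 b2 a3.1 b3.1 (a3.2.trans b3.2.symm) hI
    · intro i k j l hik hkj hjl hl
      by_contra hcon
      push Not at hcon
      have hI : Intlv i j k l := Or.inl ⟨hik, hkj, hjl⟩
      have hI' : Intlv k l i j := Or.inr ⟨hik, hkj, hjl⟩
      have main : ∀ a b a' b', a < b → b < n → a' < b' → b' < n → Intlv a' b' a b →
          (∀ x y, (x, y) ∈ R c → ¬ Intlv a b x y) →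
          (∀ x y, (x, y) ∈ R c → ¬ Intlv a' b' x y) →
          G.Adj (q a) (q b) ∧ φ s(q a, q b) ≠ c := by
        intro a b a' b' hab hb hab' hb' hI h1 h2
        have hadj : G.Adj (q a) (q b) := by
          by_contra h
          obtain ⟨x, y, hxy, hy, g1, g2, g3⟩ := hsat' a b hab hb h c
          exact h1 x y ((mem_pairsF _ _ _ _).2 ⟨hxy, hy, Or.inr ⟨g1, g2⟩⟩) g3
        refine ⟨hadj, fun hc => ?_⟩
        exact h2 a b ((mem_pairsF _ _ _ _).2 ⟨hab, hb, Or.inr ⟨hadj, hc⟩⟩) hI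
      have m1 := main i j k l (by omega) (by omega) (by omega) hl hI'
        (fun x y h => (hcon x y h).1) (fun x y h => (hcon x y h).2)
      have m2 := main k l i j (by omega) hl (by omega) (by omega) hI
        (fun x y h => (hcon x y h).2) (fun x y h => (hcon x y h).1)
      refine hnc i j k l (by omega) (by omega) (by omega) hl m1.1 m2.1 ?_ hI
      have m1' := m1.2
      have m2' := m2.2
      omega
  have hE : G.edgeSet.ncard = (pairsF n (fun i j => G.Adj (q i) (q j))).card := by
    rw [← Set.ncard_coe_finset]
    symm
    apply Set.ncard_congr (fun x _ => s(q x.1, q x.2))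
    · rintro ⟨i, j⟩ h
      exact ((mem_pairsF _ _ _ _).1 h).2.2
    · rintro ⟨i, j⟩ ⟨k, l⟩ h h' he
      obtain ⟨a1, a2, a3⟩ := (mem_pairsF _ _ _ _).1 h
      obtain ⟨b1, b2, b3⟩ := (mem_pairsF _ _ _ _).1 h'
      obtain ⟨rfl, rfl⟩ := hs i j k l a1 a2 b1 b2 he
      rfl
    · intro f hf
      obtain ⟨k, l, hkl, hl, rfl⟩ := hrep f hf
      exact ⟨(k, l), (mem_pairsF _ _ _ _).2 ⟨hkl, hl, hf⟩, rfl⟩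
  have hU : pairsF n (fun i j => G.Adj (q i) (q j)) = R 0 ∪ R 1 := by
    ext ⟨i, j⟩
    rw [Finset.mem_union, mem_pairsF, mem_pairsF, mem_pairsF]
    constructor
    · rintro ⟨h1, h2, h3⟩
      have : φ s(q i, q j) = 0 ∨ φ s(q i, q j) = 1 := by omega
      rcases this with h | h
      · exact Or.inl ⟨h1, h2, Or.inr ⟨h3, h⟩⟩
      · exact Or.inr ⟨h1, h2, Or.inr ⟨h3, h⟩⟩
    · rintro (⟨h1, h2, h3 | h3⟩ | ⟨h1, h2, h3 | h3⟩)
      · exact ⟨h1, h2, hout i j h1 h2 h3⟩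
      · exact ⟨h1, h2, h3.1⟩
      · exact ⟨h1, h2, hout i j h1 h2 h3⟩
      · exact ⟨h1, h2, h3.1⟩
  have hIn : R 0 ∩ R 1 = pairsF n (OuterP n) := by
    ext ⟨i, j⟩
    rw [Finset.mem_inter, mem_pairsF, mem_pairsF, mem_pairsF]
    constructor
    · rintro ⟨⟨h1, h2, h3⟩, ⟨-, -, h4⟩⟩
      refine ⟨h1, h2, ?_⟩
      rcases h3 with h3 | h3
      · exact h3
      rcases h4 with h4 | h4
      · exact h4
      · have := h3.2.symm.trans h4.2
        exact absurd this (by decide)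
    · rintro ⟨h1, h2, h3⟩
      exact ⟨⟨h1, h2, Or.inl h3⟩, ⟨h1, h2, Or.inl h3⟩⟩
  have hc := Finset.card_union_add_card_inter (R 0) (R 1)
  rw [← hU, ← hE, hIn, card_outer n hn] at hc
  have r0 := hR 0
  have r1 := hR 1
  omega
end
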